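/- arXiv:2305.05272 — 3 statements merged into one kernel-verified Lean document; each statement's English description precedes it below -/
import Mathlib

section
/- There exists a uniform constant C > 0 such that for every integer m ≥ 0, every α with 0 < α ≤ m + 1/2, every β with 1 ≤ β ≤ m + 3/2, every γ with 2 ≤ γ ≤ m + 5/2, and every s > 0, the following hold: s^α |F_m(s)| ≤ C α^{−1} ln(2 + m) + 4^m π, and s^β |F_m'(s)| + s^γ |F_m''(s)| ≤ C 4^m. -/
open Real MeasureTheory

noncomputable section

/-- `F_m(s) = ∫₀^π cos(mθ)/√(s + 2(1 − cos θ)) dθ`. -/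
def Fm (m : ℕ) (s : ℝ) : ℝ :=
  ∫ θ in (0:ℝ)..Real.pi, Real.cos (m * θ) / Real.sqrt (s + 2 * (1 - Real.cos θ))

/-- `F_m'(s) = −(1/2)∫₀^π cos(mθ)(s + 2(1 − cos θ))^{−3/2} dθ`. -/
def Fm' (m : ℕ) (s : ℝ) : ℝ :=
  -(1/2) * ∫ θ in (0:ℝ)..Real.pi, Real.cos (m * θ) * (s + 2 * (1 - Real.cos θ)) ^ (-(3:ℝ)/2)

/-- `F_m''(s) = (3/4)∫₀^π cos(mθ)(s + 2(1 − cos θ))^{−5/2} dθ`. -/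
def Fm'' (m : ℕ) (s : ℝ) : ℝ :=
  (3/4) * ∫ θ in (0:ℝ)..Real.pi, Real.cos (m * θ) * (s + 2 * (1 - Real.cos θ)) ^ (-(5:ℝ)/2)

/-- `cos (kθ)` is orthogonal on `[0, π]` to all powers of `cos θ` of exponent below `k`. -/
theorem integral_cos_mul_cos_pow_eq_zero (i k : ℕ) (h : i < k) :
    ∫ θ in (0:ℝ)..π, cos (k * θ) * cos θ ^ i = 0 := by
  induction i generalizing k with
  | zero =>
    have hk : (k : ℝ) ≠ 0 := by positivity
    simp [intervalIntegral.integral_comp_mul_left (fun x => cos x) hk, sin_nat_mul_pi]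
  | succ i ih =>
    obtain ⟨k, rfl⟩ : ∃ j, k = j + 1 := ⟨k - 1, by omega⟩
    have hint (j : ℕ) : IntervalIntegrable (fun θ => cos (j * θ) * cos θ ^ i) volume 0 π :=
      Continuous.intervalIntegrable (by fun_prop) _ _
    have heq (θ : ℝ) : cos ((k + 1 : ℕ) * θ) * cos θ ^ (i + 1) =
        1 / 2 * (cos ((k + 2 : ℕ) * θ) * cos θ ^ i + cos (k * θ) * cos θ ^ i) := by
      have h₁ : ((k + 2 : ℕ) : ℝ) * θ = (k + 1 : ℕ) * θ + θ := by push_cast; ring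
      have h₂ : (k : ℝ) * θ = (k + 1 : ℕ) * θ - θ := by push_cast; ring
      rw [h₁, h₂, cos_add, cos_sub]
      ring
    simp_rw [heq]
    rw [intervalIntegral.integral_const_mul, intervalIntegral.integral_add (hint _) (hint _),
      ih _ (by omega), ih _ (by omega)]
    simp

/-- A function on `[-b, b]` vanishing at the origin whose derivative is at most `K |y| ^ m`
is at most `K |y| ^ (m + 1) / (m + 1)`. -/
theorem abs_le_of_abs_deriv_le_pow {h h' : ℝ → ℝ} {b K : ℝ} (m : ℕ) (h0 : h 0 = 0)
    (hd : ∀ y, |y| ≤ b → HasDerivAt h (h' y) y) (hb : ∀ y, |y| ≤ b → |h' y| ≤ K * |y| ^ m)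
    {y : ℝ} (hy : |y| ≤ b) : |h y| ≤ K / (m + 1) * |y| ^ (m + 1) := by
  have key : ∀ ε : ℝ, |ε| = 1 → ∀ t ∈ Set.Icc (0:ℝ) b,
      |h (ε * t)| ≤ K / (m + 1) * t ^ (m + 1) := by
    intro ε hε t ht
    have habs : ∀ x ∈ Set.Icc (0:ℝ) b, |ε * x| = x := fun x hx => by
      rw [abs_mul, hε, one_mul, abs_of_nonneg hx.1]
    have hder : ∀ x ∈ Set.Icc (0:ℝ) b, HasDerivAt (fun t => h (ε * t)) (h' (ε * x) * ε) x := by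
      intro x hx
      have h₁ : HasDerivAt (fun t : ℝ => ε * t) ε x := by
        simpa using (hasDerivAt_id x).const_mul ε
      exact (hd (ε * x) (by rw [habs x hx]; exact hx.2)).comp x h₁
    have hB : ∀ x : ℝ, HasDerivAt (fun t : ℝ => K / (m + 1) * t ^ (m + 1)) (K * x ^ m) x := by
      intro x
      have hm : (m : ℝ) + 1 ≠ 0 := by positivity
      refine ((hasDerivAt_pow (m + 1) x).const_mul (K / (m + 1))).congr_deriv ?_
      push_cast
      field_simp
    have := image_norm_le_of_norm_deriv_right_le_deriv_boundary (f := fun t => h (ε * t))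
      (f' := fun t => h' (ε * t) * ε) (a := 0) (b := b)
      (fun x hx => (hder x hx).continuousAt.continuousWithinAt)
      (fun x hx => (hder x ⟨hx.1, hx.2.le⟩).hasDerivWithinAt)
      (B := fun t : ℝ => K / (m + 1) * t ^ (m + 1)) (B' := fun x => K * x ^ m)
      (by simp [h0]) (fun x => hB x) (by
        intro x hx
        have hx' : x ∈ Set.Icc (0:ℝ) b := ⟨hx.1, hx.2.le⟩
        have := hb (ε * x) (by rw [habs x hx']; exact hx'.2)
        rw [habs x hx'] at this
        simpa [abs_mul, hε] using this) ht
    simpa using this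
  rcases le_total 0 y with h | h
  · have := key 1 (by simp) y ⟨h, (le_abs_self y).trans hy⟩
    rw [abs_of_nonneg h]
    simpa using this
  · have := key (-1) (by simp) (-y) ⟨by linarith, (neg_le_abs y).trans hy⟩
    rw [abs_of_nonpos h]
    simpa using this

/-- Taylor approximation at the origin of `y ↦ (s + 2 - y) ^ (-p)` on `[-2, 2]`. -/
theorem exists_sum_approx_rpow {s : ℝ} (hs : 0 < s) (m : ℕ) : ∀ (n : ℕ) (p : ℝ), 0 < p →
    p ≤ n + 1 → ∃ a : ℕ → ℝ, ∀ y : ℝ, |y| ≤ 2 →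
      |(s + 2 - y) ^ (-p) - ∑ i ∈ Finset.range m, a i * y ^ i| ≤
        (n + m).choose m * s ^ (-p - m) * |y| ^ m := by
  induction m with
  | zero =>
    intro n p hp _
    refine ⟨0, fun y hy => ?_⟩
    have h₁ : s ≤ s + 2 - y := by linarith [(abs_le.1 hy).2]
    have h₂ : 0 ≤ (s + 2 - y) ^ (-p) := rpow_nonneg (by linarith) _
    simpa [abs_of_nonneg h₂] using rpow_le_rpow_of_nonpos hs h₁ (by linarith : -p ≤ 0)
  | succ m ih =>
    intro n p hp hpn
    obtain ⟨a, ha⟩ := ih (n + 1) (p + 1) (by linarith) (by push_cast; linarith)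
    let A : ℕ → ℝ := fun i => if i = 0 then (s + 2) ^ (-p) else p * a (i - 1) / i
    refine ⟨A, fun y hy => ?_⟩
    have hsum (y : ℝ) : ∑ i ∈ Finset.range (m + 1), A i * y ^ i =
        (∑ i ∈ Finset.range m, p * a i / (i + 1) * y ^ (i + 1)) + (s + 2) ^ (-p) := by
      rw [Finset.sum_range_succ']
      simp [A]
    have hd (y : ℝ) (hy : |y| ≤ 2) : HasDerivAt
        (fun y => (s + 2 - y) ^ (-p) - ∑ i ∈ Finset.range (m + 1), A i * y ^ i)
        (p * ((s + 2 - y) ^ (-(p + 1)) - ∑ i ∈ Finset.range m, a i * y ^ i)) y := by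
      simp_rw [hsum]
      have hpos : s + 2 - y ≠ 0 := by linarith [(abs_le.1 hy).2]
      have h₁ := ((hasDerivAt_id y).const_sub (s + 2)).rpow_const (p := -p) (Or.inl hpos)
      have h₂ : HasDerivAt (fun y : ℝ => ∑ i ∈ Finset.range m, p * a i / (i + 1) * y ^ (i + 1))
          (∑ i ∈ Finset.range m, p * (a i * y ^ i)) y := by
        refine HasDerivAt.fun_sum fun i _ => ?_
        have hi : (i : ℝ) + 1 ≠ 0 := by positivity
        refine ((hasDerivAt_pow (i + 1) y).const_mul (p * a i / (i + 1))).congr_deriv ?_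
        push_cast
        field_simp
      refine (h₁.sub (h₂.add_const _)).congr_deriv ?_
      rw [← Finset.mul_sum]
      simp only [id]
      ring_nf
    have hb (y : ℝ) (hy : |y| ≤ 2) :
        |p * ((s + 2 - y) ^ (-(p + 1)) - ∑ i ∈ Finset.range m, a i * y ^ i)| ≤
          p * ((n + 1 + m).choose m * s ^ (-(p + 1) - m)) * |y| ^ m := by
      rw [abs_mul, abs_of_pos hp, mul_assoc]
      exact mul_le_mul_of_nonneg_left (by exact_mod_cast ha y hy) hp.le
    have h0 : (s + 2 - 0) ^ (-p) - ∑ i ∈ Finset.range (m + 1), A i * (0:ℝ) ^ i = 0 := by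
      rw [hsum]
      simp
    refine (abs_le_of_abs_deriv_le_pow m h0 hd hb hy).trans ?_
    have hm : (0:ℝ) < m + 1 := by positivity
    have hch : ((n + (m + 1)).choose (m + 1) : ℝ) * (m + 1) = (n + 1 + m).choose m * (n + 1) := by
      have := Nat.choose_succ_right_eq (n + 1 + m) m
      rw [show n + 1 + m - m = n + 1 by omega] at this
      rw [show n + (m + 1) = n + 1 + m by omega]
      exact_mod_cast this
    refine mul_le_mul_of_nonneg_right ?_ (by positivity)
    rw [div_le_iff₀ hm, show -p - ((m + 1 : ℕ) : ℝ) = -(p + 1) - m by push_cast; ring,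
      mul_right_comm, hch, mul_right_comm, mul_comm p]
    gcongr

theorem add_sq_le_add_two_mul_one_sub_cos {s θ : ℝ} (h0 : 0 ≤ θ) (hπ : θ ≤ π) :
    s + (2 / π * θ) ^ 2 ≤ s + 2 * (1 - cos θ) := by
  have := cos_le_one_sub_mul_cos_sq (x := θ) (by rwa [abs_of_nonneg h0])
  have h : (2 / π * θ) ^ 2 = 2 * (2 / π ^ 2 * θ ^ 2) := by ring
  linarith

theorem add_two_mul_one_sub_cos_pos {s : ℝ} (hs : 0 < s) (θ : ℝ) : 0 < s + 2 * (1 - cos θ) := by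
  linarith [cos_le_one θ]

theorem continuous_add_two_mul_one_sub_cos_rpow {s : ℝ} (hs : 0 < s) (q : ℝ) :
    Continuous fun θ : ℝ => (s + 2 * (1 - cos θ)) ^ q :=
  Continuous.rpow_const (by fun_prop) fun θ => Or.inl (add_two_mul_one_sub_cos_pos hs θ).ne'

/-- Decay of the Fourier coefficients of `(s + 2 (1 - cos θ)) ^ (-p)` at large `s`. -/
theorem rpow_mul_abs_integral_le {s : ℝ} (hs : 0 < s) (m n : ℕ) {p : ℝ} (hp : 0 < p)
    (hpn : p ≤ n + 1) :
    s ^ (m + p) * |∫ θ in (0:ℝ)..π, cos (m * θ) * (s + 2 * (1 - cos θ)) ^ (-p)| ≤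
      (n + m).choose m * 2 ^ m * π := by
  obtain ⟨a, ha⟩ := exists_sum_approx_rpow hs m n p hp hpn
  have hzero : ∫ θ in (0:ℝ)..π, cos (m * θ) * ∑ i ∈ Finset.range m, a i * (2 * cos θ) ^ i = 0 := by
    simp_rw [Finset.mul_sum]
    rw [intervalIntegral.integral_finsetSum
      fun i _ => Continuous.intervalIntegrable (by fun_prop) _ _]
    refine Finset.sum_eq_zero fun i hi => ?_
    have heq (θ : ℝ) : cos (m * θ) * (a i * (2 * cos θ) ^ i) =
        a i * 2 ^ i * (cos (m * θ) * cos θ ^ i) := by ring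
    simp_rw [heq]
    rw [intervalIntegral.integral_const_mul,
      integral_cos_mul_cos_pow_eq_zero i m (Finset.mem_range.1 hi), mul_zero]
  have hsub : ∫ θ in (0:ℝ)..π, cos (m * θ) * (s + 2 * (1 - cos θ)) ^ (-p) =
      ∫ θ in (0:ℝ)..π, cos (m * θ) * ((s + 2 - 2 * cos θ) ^ (-p) -
        ∑ i ∈ Finset.range m, a i * (2 * cos θ) ^ i) := by
    have heq (θ : ℝ) : s + 2 - 2 * cos θ = s + 2 * (1 - cos θ) := by ring
    simp_rw [heq, mul_sub (cos _)]
    rw [intervalIntegral.integral_sub, hzero, sub_zero]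
    · exact (Continuous.mul (by fun_prop)
        (continuous_add_two_mul_one_sub_cos_rpow hs _)).intervalIntegrable _ _
    · exact Continuous.intervalIntegrable (by fun_prop) _ _
  have hbound : |∫ θ in (0:ℝ)..π, cos (m * θ) * (s + 2 * (1 - cos θ)) ^ (-p)| ≤
      (n + m).choose m * s ^ (-p - m) * 2 ^ m * |π - 0| := by
    rw [hsub]
    rw [← norm_eq_abs]
    refine intervalIntegral.norm_integral_le_of_norm_le_const fun θ _ => ?_
    have h2 : |2 * cos θ| ≤ 2 := by
      rw [abs_mul, abs_two]
      linarith [abs_cos_le_one θ]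
    rw [norm_mul, norm_eq_abs, norm_eq_abs, ← one_mul (_ * 2 ^ m)]
    refine mul_le_mul (abs_cos_le_one _) ((ha _ h2).trans ?_) (abs_nonneg _) zero_le_one
    gcongr
  calc _ ≤ s ^ (m + p) * ((n + m).choose m * s ^ (-p - m) * 2 ^ m * |π - 0|) := by gcongr
    _ = (s ^ (m + p) * s ^ (-p - m)) * ((n + m).choose m * 2 ^ m * π) := by
      rw [sub_zero, abs_of_pos pi_pos]
      ring
    _ = _ := by
      rw [← rpow_add hs, show (m : ℝ) + p + (-p - m) = 0 by ring, rpow_zero, one_mul]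

/-- Bounds at small `s`: an integrand dominating `s ^ α (s + 2 (1 - cos θ)) ^ (-p)`
dominates the Fourier coefficients. -/
theorem rpow_mul_abs_integral_le_integral {s α p : ℝ} (hs : 0 < s) (m : ℕ) {g : ℝ → ℝ}
    (hg : IntervalIntegrable g volume 0 π)
    (h : ∀ θ, 0 < θ → θ ≤ π → s ^ α * (s + 2 * (1 - cos θ)) ^ (-p) ≤ g θ) :
    s ^ α * |∫ θ in (0:ℝ)..π, cos (m * θ) * (s + 2 * (1 - cos θ)) ^ (-p)| ≤
      ∫ θ in (0:ℝ)..π, g θ := by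
  have hsα : 0 ≤ s ^ α := rpow_nonneg hs.le _
  nth_rw 1 [← abs_of_nonneg hsα]
  rw [← abs_mul, ← intervalIntegral.integral_const_mul, ← norm_eq_abs]
  refine intervalIntegral.norm_integral_le_of_norm_le pi_pos.le
    (Filter.Eventually.of_forall fun θ hθ => ?_) hg
  refine le_trans ?_ (h θ hθ.1 hθ.2)
  have hD : 0 ≤ (s + 2 * (1 - cos θ)) ^ (-p) := rpow_nonneg (add_two_mul_one_sub_cos_pos hs θ).le _
  rw [norm_eq_abs, abs_mul, abs_mul, abs_of_nonneg hsα, abs_of_nonneg hD]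
  exact mul_le_mul_of_nonneg_left (mul_le_of_le_one_left hD (abs_cos_le_one _)) hsα

theorem rpow_mul_abs_integral_le_div {s α : ℝ} (hs : 0 < s) (m : ℕ) (hα : 0 < α)
    (hα' : α ≤ 1 / 2) :
    s ^ α * |∫ θ in (0:ℝ)..π, cos (m * θ) * (s + 2 * (1 - cos θ)) ^ (-(1 / 2 : ℝ))| ≤
      π / (2 * α) := by
  have hint : IntervalIntegrable (fun θ : ℝ => (2 / π) ^ (2 * α - 1) * θ ^ (2 * α - 1))
      volume 0 π := (intervalIntegral.intervalIntegrable_rpow' (by linarith)).const_mul _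
  refine (rpow_mul_abs_integral_le_integral hs m hint fun θ h0 hπ => ?_).trans ?_
  · have hD := add_two_mul_one_sub_cos_pos hs θ
    have hx : 0 < 2 / π * θ := by have := pi_pos; positivity
    have hle : (2 / π * θ) ^ 2 ≤ s + 2 * (1 - cos θ) := by
      linarith [add_sq_le_add_two_mul_one_sub_cos (s := s) h0.le hπ]
    calc s ^ α * (s + 2 * (1 - cos θ)) ^ (-(1 / 2 : ℝ))
        ≤ (s + 2 * (1 - cos θ)) ^ α * (s + 2 * (1 - cos θ)) ^ (-(1 / 2 : ℝ)) := by
          gcongr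
          linarith [cos_le_one θ]
      _ = (s + 2 * (1 - cos θ)) ^ (α - 1 / 2) := by rw [← rpow_add hD]; ring_nf
      _ ≤ ((2 / π * θ) ^ 2) ^ (α - 1 / 2) :=
          rpow_le_rpow_of_nonpos (by positivity) hle (by linarith)
      _ = (2 / π * θ) ^ (2 * α - 1) := by
          rw [← rpow_natCast, ← rpow_mul hx.le]
          congr 1
          push_cast
          ring
      _ = _ := mul_rpow (by positivity) h0.le
  · rw [intervalIntegral.integral_const_mul, integral_rpow (Or.inl (by linarith)),
      sub_add_cancel, zero_rpow (by linarith), sub_zero, ← mul_div_assoc]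
    gcongr
    have h1 : (2 / π) ^ (2 * α - 1) * π ^ (2 * α) = 2 ^ (2 * α - 1) * π := by
      rw [div_rpow two_pos.le pi_pos.le, rpow_sub_one pi_pos.ne']
      have := (rpow_pos_of_pos pi_pos (2 * α)).ne'
      field_simp
    rw [h1]
    exact mul_le_of_le_one_left pi_pos.le
      (rpow_le_one_of_one_le_of_nonpos one_le_two (by linarith))

theorem hasDerivAt_mul_rpow_neg_half {s : ℝ} (hs : 0 < s) (c θ : ℝ) :
    HasDerivAt (fun θ : ℝ => θ * (s + (c * θ) ^ 2) ^ (-(1 / 2 : ℝ)))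
      (s * (s + (c * θ) ^ 2) ^ (-(3 / 2 : ℝ))) θ := by
  have hD : 0 < s + (c * θ) ^ 2 := by positivity
  have h₁ : HasDerivAt (fun θ : ℝ => s + (c * θ) ^ 2) (2 * c ^ 2 * θ) θ := by
    refine ((((hasDerivAt_id θ).const_mul c).pow 2).const_add s).congr_deriv ?_
    simp
    ring
  refine ((hasDerivAt_id θ).mul (h₁.rpow_const (p := -(1 / 2 : ℝ)) (Or.inl hD.ne'))).congr_deriv ?_
  have h₂ : (s + (c * θ) ^ 2) ^ (-(1 / 2 : ℝ)) =
      (s + (c * θ) ^ 2) ^ (-(3 / 2 : ℝ)) * (s + (c * θ) ^ 2) := by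
    rw [← rpow_add_one hD.ne']
    norm_num
  rw [h₂, show (-(1 / 2 : ℝ) - 1) = -(3 / 2) by norm_num]
  simp only [id]
  ring

theorem integral_mul_rpow_le {s : ℝ} (hs : 0 < s) :
    IntervalIntegrable (fun θ : ℝ => s * (s + (2 / π * θ) ^ 2) ^ (-(3 / 2 : ℝ))) volume 0 π ∧
      ∫ θ in (0:ℝ)..π, s * (s + (2 / π * θ) ^ 2) ^ (-(3 / 2 : ℝ)) ≤ π / 2 := by
  have hint : IntervalIntegrable (fun θ : ℝ => s * (s + (2 / π * θ) ^ 2) ^ (-(3 / 2 : ℝ)))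
      volume 0 π :=
    (Continuous.mul continuous_const (Continuous.rpow_const (by fun_prop)
      fun θ => Or.inl (by positivity))).intervalIntegrable _ _
  refine ⟨hint, ?_⟩
  rw [intervalIntegral.integral_eq_sub_of_hasDerivAt
    (fun θ _ => hasDerivAt_mul_rpow_neg_half hs (2 / π) θ) hint, zero_mul, sub_zero,
    div_eq_mul_inv π 2]
  refine mul_le_mul_of_nonneg_left ?_ pi_pos.le
  have h4 : ((2:ℝ) ^ 2) ^ (-(1 / 2 : ℝ)) = 2⁻¹ := by
    rw [← rpow_natCast, ← rpow_mul two_pos.le]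
    norm_num
  have hc : (2 / π * π) ^ 2 = 2 ^ 2 := by rw [div_mul_cancel₀ _ pi_pos.ne']
  rw [← h4, hc]
  exact rpow_le_rpow_of_nonpos (by norm_num) (by linarith) (by norm_num)

theorem rpow_mul_abs_integral_le_pi_div_two {s : ℝ} (hs : 0 < s) (m : ℕ) {q : ℝ} (hq : 1 ≤ q) :
    s ^ q * |∫ θ in (0:ℝ)..π, cos (m * θ) * (s + 2 * (1 - cos θ)) ^ (-(q + 1 / 2))| ≤ π / 2 := by
  obtain ⟨hint, hle⟩ := integral_mul_rpow_le hs
  refine (rpow_mul_abs_integral_le_integral hs m hint fun θ h0 hπ => ?_).trans hle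
  have hD := add_two_mul_one_sub_cos_pos hs θ
  have hge := add_sq_le_add_two_mul_one_sub_cos (s := s) h0.le hπ
  have hsD : s ≤ s + 2 * (1 - cos θ) := by linarith [cos_le_one θ]
  calc s ^ q * (s + 2 * (1 - cos θ)) ^ (-(q + 1 / 2))
      = s * (s ^ (q - 1) * (s + 2 * (1 - cos θ)) ^ (-(q + 1 / 2))) := by
        rw [rpow_sub_one hs.ne']
        field_simp
    _ ≤ s * ((s + 2 * (1 - cos θ)) ^ (q - 1) * (s + 2 * (1 - cos θ)) ^ (-(q + 1 / 2))) := by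
        have : 0 ≤ q - 1 := by linarith
        gcongr
    _ = s * (s + 2 * (1 - cos θ)) ^ (-(3 / 2 : ℝ)) := by
        rw [← rpow_add hD]
        ring_nf
    _ ≤ _ := mul_le_mul_of_nonneg_left
        (rpow_le_rpow_of_nonpos (by positivity) hge (by norm_num)) hs.le

/-- Interpolation between two power bounds. -/
theorem rpow_mul_le_of_endpoints {s a b β x M : ℝ} (hs : 0 < s) (ha : a ≤ β) (hb : β ≤ b)
    (hx : 0 ≤ x) (h₁ : s ^ a * x ≤ M) (h₂ : s ^ b * x ≤ M) : s ^ β * x ≤ M := by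
  rcases le_total s 1 with h | h
  · exact (mul_le_mul_of_nonneg_right (rpow_le_rpow_of_exponent_ge hs h ha) hx).trans h₁
  · exact (mul_le_mul_of_nonneg_right (rpow_le_rpow_of_exponent_le h hb) hx).trans h₂

theorem Fm_eq {s : ℝ} (hs : 0 < s) (m : ℕ) :
    Fm m s = ∫ θ in (0:ℝ)..π, cos (m * θ) * (s + 2 * (1 - cos θ)) ^ (-(1 / 2 : ℝ)) := by
  refine intervalIntegral.integral_congr fun θ _ => ?_
  simp only [sqrt_eq_rpow, rpow_neg (add_two_mul_one_sub_cos_pos hs θ).le, div_eq_mul_inv]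

theorem choose_one_add_le (m : ℕ) : ((1 + m).choose m : ℝ) ≤ 2 ^ m := by
  have h : (1 + m).choose m = m + 1 := by rw [add_comm, Nat.choose_succ_self_right]
  rw [h]
  exact_mod_cast Nat.lt_two_pow_self

theorem choose_two_add_le (m : ℕ) : ((2 + m).choose m : ℝ) ≤ 2 * 2 ^ m := by
  have h₁ : (m + 2) * (m + 1) ≤ 4 * 2 ^ m := by
    induction m with
    | zero => simp
    | succ m ih =>
      rcases m with _ | m
      · norm_num
      · rw [pow_succ 2 (m + 1)]
        nlinarith
  have h₂ : (2 + m).choose m ≤ 2 * 2 ^ m := by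
    rw [← Nat.choose_symm_add, Nat.choose_two_right, add_comm 2 m,
      show m + 2 - 1 = m + 1 by omega]
    omega
  exact_mod_cast h₂

theorem rpow_mul_abs_Fm_le {s : ℝ} (hs : 0 < s) (m : ℕ) {α : ℝ} (hα : 1 / 2 ≤ α)
    (hα' : α ≤ m + 1 / 2) : s ^ α * |Fm m s| ≤ 4 ^ m * π := by
  rw [Fm_eq hs]
  have h24 : (2:ℝ) ^ m ≤ 4 ^ m := by gcongr; norm_num
  refine rpow_mul_le_of_endpoints hs hα hα' (abs_nonneg _) ?_ ?_
  · refine (rpow_mul_abs_integral_le_integral (g := fun _ => 1) hs m (by simp)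
      fun θ _ _ => ?_).trans ?_
    · have hD := add_two_mul_one_sub_cos_pos hs θ
      calc s ^ (1 / 2 : ℝ) * (s + 2 * (1 - cos θ)) ^ (-(1 / 2 : ℝ))
          ≤ s ^ (1 / 2 : ℝ) * s ^ (-(1 / 2 : ℝ)) :=
            mul_le_mul_of_nonneg_left (rpow_le_rpow_of_nonpos hs
              (by linarith [cos_le_one θ]) (by norm_num)) (by positivity)
        _ = 1 := by rw [← rpow_add hs]; norm_num
    · have : (1:ℝ) ≤ 4 ^ m := one_le_pow₀ (by norm_num)
      simpa using le_mul_of_one_le_left pi_pos.le this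
  · refine (rpow_mul_abs_integral_le hs m 0 (by norm_num) (by norm_num)).trans ?_
    simp only [zero_add, Nat.choose_self, Nat.cast_one, one_mul]
    gcongr

theorem rpow_mul_abs_Fm'_le {s : ℝ} (hs : 0 < s) (m : ℕ) {β : ℝ} (hβ : 1 ≤ β)
    (hβ' : β ≤ m + 3 / 2) : s ^ β * |Fm' m s| ≤ 4 ^ m * (π / 2) := by
  have h4 : (4:ℝ) ^ m = 2 ^ m * 2 ^ m := by rw [← mul_pow]; norm_num
  have h1 : (1:ℝ) ≤ 4 ^ m := one_le_pow₀ (by norm_num)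
  have hπ := pi_pos
  have key := rpow_mul_le_of_endpoints (M := 4 ^ m * π) hs hβ hβ' (abs_nonneg
    (∫ θ in (0:ℝ)..π, cos (m * θ) * (s + 2 * (1 - cos θ)) ^ (-(3:ℝ) / 2))) ?_ ?_
  · rw [Fm', abs_mul, show |(-(1 / 2) : ℝ)| = 1 / 2 by norm_num]
    linarith
  · have := rpow_mul_abs_integral_le_pi_div_two hs m le_rfl
    rw [show (-(1 + 1 / 2) : ℝ) = -3 / 2 by norm_num] at this
    nlinarith
  · have := rpow_mul_abs_integral_le hs m 1 (p := 3 / 2) (by norm_num) (by norm_num)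
    rw [show (-(3 / 2) : ℝ) = -3 / 2 by norm_num] at this
    refine this.trans ?_
    rw [h4]
    gcongr
    exact choose_one_add_le m

theorem rpow_mul_abs_Fm''_le {s : ℝ} (hs : 0 < s) (m : ℕ) {γ : ℝ} (hγ : 2 ≤ γ)
    (hγ' : γ ≤ m + 5 / 2) : s ^ γ * |Fm'' m s| ≤ 4 ^ m * (3 / 2 * π) := by
  have h4 : (4:ℝ) ^ m = 2 ^ m * 2 ^ m := by rw [← mul_pow]; norm_num
  have h1 : (1:ℝ) ≤ 4 ^ m := one_le_pow₀ (by norm_num)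
  have hπ := pi_pos
  have key := rpow_mul_le_of_endpoints (M := 2 * 4 ^ m * π) hs hγ hγ' (abs_nonneg
    (∫ θ in (0:ℝ)..π, cos (m * θ) * (s + 2 * (1 - cos θ)) ^ (-(5:ℝ) / 2))) ?_ ?_
  · rw [Fm'', abs_mul, show |(3 / 4 : ℝ)| = 3 / 4 by norm_num]
    linarith
  · have := rpow_mul_abs_integral_le_pi_div_two hs m one_le_two
    rw [show (-(2 + 1 / 2) : ℝ) = -5 / 2 by norm_num] at this
    nlinarith
  · have := rpow_mul_abs_integral_le hs m 2 (p := 5 / 2) (by norm_num) (by norm_num)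
    rw [show (-(5 / 2) : ℝ) = -5 / 2 by norm_num] at this
    refine this.trans ?_
    rw [h4, ← mul_assoc]
    gcongr
    exact choose_two_add_le m

/-- Lemma 2.2 (propa1): uniform asymptotic bounds on `F_m`, `F_m'`, `F_m''`. -/
theorem Fm_asymptotic_bounds :
    ∃ C : ℝ, 0 < C ∧ ∀ (m : ℕ) (α β γ s : ℝ),
      0 < α → α ≤ (m : ℝ) + 1/2 →
      1 ≤ β → β ≤ (m : ℝ) + 3/2 →
      2 ≤ γ → γ ≤ (m : ℝ) + 5/2 →
      0 < s →
      s ^ α * |Fm m s| ≤ C * α⁻¹ * Real.log (2 + (m : ℝ)) + 4 ^ m * Real.pi ∧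
      s ^ β * |Fm' m s| + s ^ γ * |Fm'' m s| ≤ C * 4 ^ m := by
  refine ⟨10, by norm_num, fun m α β γ s hα hα' hβ hβ' hγ hγ' hs => ⟨?_, ?_⟩⟩
  · have hlog : 1 / 2 ≤ log (2 + (m : ℝ)) := by
      have := log_le_log two_pos (by linarith [m.cast_nonneg (α := ℝ)] : (2:ℝ) ≤ 2 + m)
      linarith [log_two_gt_d9]
    have hα'' : 0 < α⁻¹ := inv_pos.2 hα
    rcases le_total α (1 / 2) with h | h
    · have hF := rpow_mul_abs_integral_le_div hs m hα h
      rw [← Fm_eq hs] at hF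
      have h₁ : π / (2 * α) = α⁻¹ * (π / 2) := by field_simp
      have h₂ : α⁻¹ * (π / 2) ≤ α⁻¹ * (10 * log (2 + (m : ℝ))) := by
        gcongr
        linarith [pi_lt_four]
      have h₃ : 0 ≤ 4 ^ m * π := by positivity
      linarith
    · have hF := rpow_mul_abs_Fm_le hs m h hα'
      have : 0 ≤ 10 * α⁻¹ * log (2 + (m : ℝ)) := by positivity
      linarith
  · have h₁ := rpow_mul_abs_Fm'_le hs m hβ hβ'
    have h₂ := rpow_mul_abs_Fm''_le hs m hγ hγ'
    have h₃ : (4:ℝ) ^ m * (π / 2) + 4 ^ m * (3 / 2 * π) ≤ 10 * 4 ^ m := by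
      have : (0:ℝ) < 4 ^ m := by positivity
      nlinarith [pi_lt_four, pi_lt_d2]
    linarith

end
end

section
/- There exists a uniform constant C > 0 such that for every integer m ≥ 3, every α with 1 ≤ α ≤ 7/2, every β with 2 ≤ β ≤ 9/2, every γ with 3 ≤ γ ≤ 11/2, and every s > 0, the following hold: s^α |F_m(s)| ≤ C/m, and s^β |F_m'(s)| + s^γ |F_m''(s)| ≤ C/m. -/
open Real MeasureTheory

noncomputable section

/-- `∫₀^π cos(nθ) (s + 2(1 − cos θ))^{−p} dθ`. -/
def cosKernel (p : ℝ) (n : ℕ) (s : ℝ) : ℝ :=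
  ∫ θ in (0:ℝ)..Real.pi, Real.cos (n * θ) * (s + 2 * (1 - Real.cos θ)) ^ (-p)

lemma kernel_base_pos {s : ℝ} (hs : 0 < s) (θ : ℝ) : 0 < s + 2 * (1 - Real.cos θ) := by
  linarith [Real.cos_le_one θ]

lemma continuous_kernel_rpow {s : ℝ} (hs : 0 < s) (q : ℝ) :
    Continuous fun θ : ℝ => (s + 2 * (1 - Real.cos θ)) ^ q :=
  Continuous.rpow_const (by fun_prop) fun θ => Or.inl (kernel_base_pos hs θ).ne'

lemma hasDerivAt_kernel_rpow {s : ℝ} (hs : 0 < s) (p θ : ℝ) :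
    HasDerivAt (fun θ : ℝ => (s + 2 * (1 - Real.cos θ)) ^ (-p))
      (-(2 * p) * (Real.sin θ * (s + 2 * (1 - Real.cos θ)) ^ (-(p + 1)))) θ := by
  have h : HasDerivAt (fun θ : ℝ => s + 2 * (1 - Real.cos θ)) (2 * Real.sin θ) θ := by
    simpa using (((Real.hasDerivAt_cos θ).const_sub 1).const_mul 2).const_add s
  convert h.rpow_const (p := -p) (Or.inl (kernel_base_pos hs θ).ne') using 1
  rw [show -p - 1 = -(p + 1) by ring]
  ring

/-- Integration by parts, integrating the cosine. -/
lemma mul_cosKernel {s : ℝ} (hs : 0 < s) (p : ℝ) (n : ℕ) :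
    n * cosKernel p n s = 2 * p * ∫ θ in (0:ℝ)..Real.pi,
      Real.sin (n * θ) * (Real.sin θ * (s + 2 * (1 - Real.cos θ)) ^ (-(p + 1))) := by
  have hc := continuous_kernel_rpow hs (-p)
  have hc' := continuous_kernel_rpow hs (-(p + 1))
  have hd : ∀ θ ∈ Set.uIcc 0 Real.pi, HasDerivAt
      (fun θ : ℝ => Real.sin (n * θ) * (s + 2 * (1 - Real.cos θ)) ^ (-p))
      (n * (Real.cos (n * θ) * (s + 2 * (1 - Real.cos θ)) ^ (-p)) - 2 * p *
        (Real.sin (n * θ) * (Real.sin θ * (s + 2 * (1 - Real.cos θ)) ^ (-(p + 1))))) θ := by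
    intro θ _
    have h : HasDerivAt (fun θ : ℝ => Real.sin (n * θ)) (Real.cos (n * θ) * n) θ := by
      simpa using ((hasDerivAt_id θ).const_mul (n : ℝ)).sin
    refine (h.mul (hasDerivAt_kernel_rpow hs p θ)).congr_deriv ?_
    ring
  have h := intervalIntegral.integral_eq_sub_of_hasDerivAt hd
    (Continuous.intervalIntegrable (by fun_prop) _ _)
  rw [intervalIntegral.integral_sub (Continuous.intervalIntegrable (by fun_prop) _ _)
    (Continuous.intervalIntegrable (by fun_prop) _ _), intervalIntegral.integral_const_mul,
    intervalIntegral.integral_const_mul] at h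
  simp only [Real.sin_nat_mul_pi, mul_zero, Real.sin_zero, zero_mul, sub_zero] at h
  exact sub_eq_zero.mp h

lemma succ_mul_cosKernel {s : ℝ} (hs : 0 < s) (p : ℝ) (n : ℕ) :
    (n + 1 : ℝ) * cosKernel p (n + 1) s =
      p * (cosKernel (p + 1) n s - cosKernel (p + 1) (n + 2) s) := by
  have hc := continuous_kernel_rpow hs (-(p + 1))
  have h := mul_cosKernel hs p (n + 1)
  push_cast at h
  rw [h, cosKernel, cosKernel, ← intervalIntegral.integral_sub
    (Continuous.intervalIntegrable (by fun_prop) _ _)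
    (Continuous.intervalIntegrable (by fun_prop) _ _), mul_comm 2 p, mul_assoc,
    ← intervalIntegral.integral_const_mul]
  congr 2
  ext θ
  push_cast
  rw [show (n : ℝ) * θ = (n + 1) * θ - θ by ring,
    show ((n : ℝ) + 2) * θ = (n + 1) * θ + θ by ring, Real.cos_sub, Real.cos_add]
  ring

lemma abs_cosKernel_le {s p : ℝ} (hs : 0 < s) (hp : 0 ≤ p) (n : ℕ) :
    |cosKernel p n s| ≤ Real.pi * s ^ (-p) := by
  have h := intervalIntegral.norm_integral_le_of_norm_le_const (a := 0) (b := Real.pi)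
    (C := s ^ (-p))
    (f := fun θ : ℝ => Real.cos (n * θ) * (s + 2 * (1 - Real.cos θ)) ^ (-p)) (by
      intro θ _
      have hu := kernel_base_pos hs θ
      rw [norm_mul, Real.norm_eq_abs, Real.norm_of_nonneg (Real.rpow_nonneg hu.le _)]
      calc _ ≤ 1 * (s + 2 * (1 - Real.cos θ)) ^ (-p) := by
            gcongr
            exact Real.abs_cos_le_one _
        _ ≤ s ^ (-p) := by
            rw [one_mul]
            exact Real.rpow_le_rpow_of_nonpos hs (by linarith [Real.cos_le_one θ]) (by linarith))
  rw [sub_zero, abs_of_pos Real.pi_pos, mul_comm] at h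
  exact h

lemma mul_abs_cosKernel_le {s p : ℝ} (hs : 0 < s) (hp : 0 ≤ p) (n : ℕ) :
    n * |cosKernel p n s| ≤ s ^ (-p) := by
  have hc' := continuous_kernel_rpow hs (-(p + 1))
  have hftc := intervalIntegral.integral_eq_sub_of_hasDerivAt (a := 0) (b := Real.pi)
    (fun θ _ => hasDerivAt_kernel_rpow hs p θ)
    (Continuous.intervalIntegrable (by fun_prop) _ _)
  rw [intervalIntegral.integral_const_mul] at hftc
  simp only [Real.cos_pi, Real.cos_zero, sub_self, mul_zero, add_zero] at hftc
  have hb : |∫ θ in (0:ℝ)..Real.pi,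
      Real.sin (n * θ) * (Real.sin θ * (s + 2 * (1 - Real.cos θ)) ^ (-(p + 1)))| ≤
      ∫ θ in (0:ℝ)..Real.pi, Real.sin θ * (s + 2 * (1 - Real.cos θ)) ^ (-(p + 1)) := by
    rw [← Real.norm_eq_abs]
    refine intervalIntegral.norm_integral_le_of_norm_le Real.pi_pos.le
      (ae_of_all _ fun θ hθ => ?_) (Continuous.intervalIntegrable (by fun_prop) _ _)
    have h0 : 0 ≤ Real.sin θ * (s + 2 * (1 - Real.cos θ)) ^ (-(p + 1)) :=
      mul_nonneg (Real.sin_nonneg_of_nonneg_of_le_pi hθ.1.le hθ.2)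
        (Real.rpow_nonneg (kernel_base_pos hs θ).le _)
    rw [norm_mul, Real.norm_eq_abs, Real.norm_of_nonneg h0]
    exact mul_le_of_le_one_left h0 (Real.abs_sin_le_one _)
  have h := congrArg abs (mul_cosKernel hs p n)
  rw [abs_mul, abs_mul, Nat.abs_cast, abs_of_nonneg (by positivity : 0 ≤ 2 * p)] at h
  rw [h]
  have h4 : 0 ≤ (s + 2 * (1 - (-1 : ℝ))) ^ (-p) := Real.rpow_nonneg (by linarith) _
  have := mul_le_mul_of_nonneg_left hb (by positivity : 0 ≤ 2 * p)
  linarith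

lemma mul_abs_cosKernel_le_of_forall {s p A : ℝ} (hs : 0 < s) (hp : 0 ≤ p) {k : ℕ}
    (hA : ∀ n, k ≤ n → |cosKernel (p + 1) n s| ≤ A) {n : ℕ} (hn : k + 1 ≤ n) :
    n * |cosKernel p n s| ≤ 2 * p * A := by
  obtain ⟨n, rfl⟩ : ∃ j, n = j + 1 := ⟨n - 1, by omega⟩
  have h := congrArg abs (succ_mul_cosKernel hs p n)
  rw [abs_mul, abs_mul, abs_of_nonneg (by positivity : (0 : ℝ) ≤ n + 1), abs_of_nonneg hp] at h
  push_cast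
  rw [h]
  calc _ ≤ p * (A + A) := by
        gcongr
        exact (abs_sub _ _).trans (add_le_add (hA _ (by omega)) (hA _ (by omega)))
    _ = 2 * p * A := by ring

lemma abs_cosKernel_le_of_forall {s p A : ℝ} (hs : 0 < s) (hp : 0 ≤ p) {k : ℕ}
    (hA : ∀ n, k ≤ n → |cosKernel (p + 1) n s| ≤ A) {n : ℕ} (hn : k + 1 ≤ n) :
    |cosKernel p n s| ≤ 2 * p * A := by
  refine le_trans ?_ (mul_abs_cosKernel_le_of_forall hs hp hA hn)
  exact le_mul_of_one_le_left (abs_nonneg _) (by exact_mod_cast (by omega : 1 ≤ n))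

lemma mul_abs_cosKernel_le_of_three_le {s p : ℝ} (hs : 0 < s) (hp : 0 ≤ p) {n : ℕ}
    (hn : 3 ≤ n) :
    n * |cosKernel p n s| ≤ 8 * Real.pi * p * (p + 1) * (p + 2) * s ^ (-(p + 3)) := by
  have h := mul_abs_cosKernel_le_of_forall hs hp (k := 2) (fun n hn =>
    abs_cosKernel_le_of_forall hs (by positivity) (k := 1) (fun n hn =>
      abs_cosKernel_le_of_forall hs (by positivity) (k := 0) (fun n _ =>
        abs_cosKernel_le hs (by positivity) n) hn) hn) hn
  refine h.trans_eq ?_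
  rw [show p + 1 + 1 + 1 = p + 3 by ring]
  ring

lemma rpow_mul_abs_cosKernel_le {s p a : ℝ} (hs : 0 < s) (hp : 0 ≤ p) (ha : p ≤ a)
    (ha' : a ≤ p + 3) {n : ℕ} (hn : 3 ≤ n) :
    s ^ a * |cosKernel p n s| ≤ (1 + 8 * Real.pi * p * (p + 1) * (p + 2)) / n := by
  have hn0 : (0 : ℝ) < n := by exact_mod_cast (by omega : 0 < n)
  have hB : 0 ≤ 8 * Real.pi * p * (p + 1) * (p + 2) := by positivity
  have hsa : 0 ≤ s ^ a := Real.rpow_nonneg hs.le a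
  rw [le_div_iff₀ hn0, mul_assoc, mul_comm |_|]
  rcases le_total s 1 with h1 | h1
  · have h := mul_le_mul_of_nonneg_left (mul_abs_cosKernel_le hs hp n) hsa
    rw [← Real.rpow_add hs] at h
    linarith [Real.rpow_le_one hs.le h1 (by linarith : 0 ≤ a + -p)]
  · have h := mul_le_mul_of_nonneg_left (mul_abs_cosKernel_le_of_three_le hs hp hn) hsa
    rw [mul_left_comm (s ^ a) (8 * Real.pi * p * (p + 1) * (p + 2)), ← Real.rpow_add hs] at h
    have h' := mul_le_mul_of_nonneg_left
      (Real.rpow_le_one_of_one_le_of_nonpos h1 (by linarith : a + -(p + 3) ≤ 0)) hB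
    linarith

lemma Fm_eq_cosKernel {s : ℝ} (hs : 0 < s) (m : ℕ) : Fm m s = cosKernel (1 / 2) m s := by
  unfold Fm cosKernel
  congr 1
  ext θ
  rw [Real.rpow_neg (kernel_base_pos hs θ).le, ← Real.sqrt_eq_rpow, div_eq_mul_inv]

lemma Fm'_eq_cosKernel (m : ℕ) (s : ℝ) : Fm' m s = -(1 / 2) * cosKernel (3 / 2) m s := by
  simp only [Fm', cosKernel, neg_div]

lemma Fm''_eq_cosKernel (m : ℕ) (s : ℝ) : Fm'' m s = 3 / 4 * cosKernel (5 / 2) m s := by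
  simp only [Fm'', cosKernel, neg_div]

/-- Lemma 2.3 (propa2), part (i): decay of `F_m`, `F_m'`, `F_m''` in `m`. -/
theorem Fm_large_m_bounds :
    ∃ C : ℝ, 0 < C ∧ ∀ (m : ℕ), 3 ≤ m → ∀ (α β γ s : ℝ),
      1 ≤ α → α ≤ 7/2 →
      2 ≤ β → β ≤ 9/2 →
      3 ≤ γ → γ ≤ 11/2 →
      0 < s →
      s ^ α * |Fm m s| ≤ C / (m : ℝ) ∧
      s ^ β * |Fm' m s| + s ^ γ * |Fm'' m s| ≤ C / (m : ℝ) := by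
  have hpi := Real.pi_pos
  refine ⟨2 + 1000 * Real.pi, by positivity, ?_⟩
  intro m hm α β γ s hα hα' hβ hβ' hγ hγ' hs
  have hm0 : (0 : ℝ) < m := by exact_mod_cast (by omega : 0 < m)
  have h1 := rpow_mul_abs_cosKernel_le hs (p := 1 / 2) (a := α) (by norm_num) (by linarith)
    (by linarith) hm
  have h2 := rpow_mul_abs_cosKernel_le hs (p := 3 / 2) (a := β) (by norm_num) (by linarith)
    (by linarith) hm
  have h3 := rpow_mul_abs_cosKernel_le hs (p := 5 / 2) (a := γ) (by norm_num) (by linarith)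
    (by linarith) hm
  rw [Fm_eq_cosKernel hs, Fm'_eq_cosKernel, Fm''_eq_cosKernel, abs_mul, abs_mul,
    show |-(1 / 2 : ℝ)| = 1 / 2 by norm_num [abs_of_pos], abs_of_pos (by norm_num : (0 : ℝ) < 3 / 4)]
  rw [le_div_iff₀ hm0] at h1 h2 h3 ⊢
  rw [le_div_iff₀ hm0]
  constructor <;> nlinarith

end
end

section
/- Let m ≥ 0 be an integer and let a : (0,∞)×ℝ → ℝ be smooth and compactly supported. Then for every r > 0 and z ∈ ℝ the following integral identity holds: (1/4π) ∫₀^∞ ∫_ℝ ∫₀^{2π} a(r̄,z̄) cos(m θ̄) ((r − r̄)² + (z − z̄)² + 2 r r̄ (1 − cos θ̄))^{−1/2} r̄ dθ̄ dz̄ dr̄ = (1/2π) ∫₀^∞ ∫_ℝ F_m(ξ²) a(r̄,z̄) √(r̄/r) dz̄ dr̄, where ξ² := ((r − r̄)² + (z − z̄)²)/(r r̄). (The left-hand side is the Newtonian potential (−Δ)^{−1} of the function x ↦ a(r̄,z̄) cos(m θ̄) on ℝ³ evaluated at the point (r, 0, z), using that |x − x̄|² = (r − r̄)² + (z − z̄)²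 + 2 r r̄ (1 − cos(θ − θ̄)) in cylindrical coordinates.) -/
open Real MeasureTheory Set

noncomputable section

/-- An integral over `[0, 2c]` of a function symmetric about `c` is twice the integral over `[0, c]`;
no integrability is required. -/
theorem intervalIntegral_zero_two_mul_of_symm {f : ℝ → ℝ} {c : ℝ} (hc : 0 ≤ c)
    (hf : ∀ x, f (2 * c - x) = f x) :
    ∫ x in (0:ℝ)..(2 * c), f x = 2 * ∫ x in (0:ℝ)..c, f x := by
  by_cases h : IntervalIntegrable f volume 0 c
  · have h' : IntervalIntegrable f volume c (2 * c) := by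
      have := (h.comp_sub_left (2 * c)).symm
      simp only [hf, sub_zero] at this
      convert this using 1
      ring
    have hint : ∫ x in c..(2 * c), f x = ∫ x in (0:ℝ)..c, f x := by
      have := intervalIntegral.integral_comp_sub_left (a := 0) (b := c) f (2 * c)
      simp only [hf, sub_zero] at this
      rw [this]
      congr 1
      ring
    rw [← intervalIntegral.integral_add_adjacent_intervals h h', hint]
    ring
  · have h' : ¬ IntervalIntegrable f volume 0 (2 * c) := fun h₂ =>
      h (h₂.mono_set (by
        rw [uIcc_of_le hc, uIcc_of_le (by linarith)]
        exact Icc_subset_Icc le_rfl (by linarith)))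
    rw [intervalIntegral.integral_undef h, intervalIntegral.integral_undef h', mul_zero]

/-- The angular integral of the Newtonian kernel expressed through `Fm`. -/
theorem angular_integral_eq_Fm (m : ℕ) (α z z' : ℝ) {r r' : ℝ} (hr : 0 < r) (hr' : 0 < r') :
    ∫ θ in (0:ℝ)..(2*Real.pi), α * Real.cos (m * θ) /
        Real.sqrt ((r - r')^2 + (z - z')^2 + 2*r*r'*(1 - Real.cos θ)) * r'
      = 2 * (Fm m (((r - r')^2 + (z - z')^2)/(r*r')) * α * Real.sqrt (r'/r)) := by
  rw [intervalIntegral_zero_two_mul_of_symm Real.pi_pos.le, Fm,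
    mul_assoc (intervalIntegral _ _ _ _), ← intervalIntegral.integral_mul_const]
  · congr 1
    refine intervalIntegral.integral_congr fun θ _ => ?_
    have hkernel : (r - r')^2 + (z - z')^2 + 2*r*r'*(1 - Real.cos θ)
        = (r * r') * (((r - r')^2 + (z - z')^2)/(r*r') + 2 * (1 - Real.cos θ)) := by
      field_simp
    have hweight : r' / Real.sqrt (r * r') = Real.sqrt (r' / r) := by
      rw [Real.sqrt_mul hr.le, Real.sqrt_div hr'.le]
      nth_rewrite 1 [← Real.mul_self_sqrt hr'.le]
      have := Real.sqrt_pos.2 hr'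
      have := Real.sqrt_pos.2 hr
      field_simp
    rw [hkernel, Real.sqrt_mul (by positivity), ← hweight]
    simp only [div_eq_mul_inv, mul_inv]
    ring
  · intro θ
    have h : (m : ℝ) * (2 * Real.pi - θ) = m * (2 * Real.pi) - m * θ := by ring
    rw [h, Real.cos_nat_mul_two_pi_sub, Real.cos_two_pi_sub]

/-- Identity (2.2)/(a2): the Newtonian potential of `a(r̄,z̄) cos(m θ̄)` evaluated at
`(r, 0, z)` equals `(1/2π) ∫ F_m(ξ²) a(r̄,z̄) √(r̄/r) dr̄ dz̄`. -/
theorem newtonian_potential_cylindrical (m : ℕ) (a : ℝ → ℝ → ℝ)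
    (ha_smooth : ContDiff ℝ (⊤ : ℕ∞) (Function.uncurry a))
    (ha_cpt : HasCompactSupport (Function.uncurry a))
    (ha_supp : tsupport (Function.uncurry a) ⊆ Set.Ioi (0:ℝ) ×ˢ Set.univ)
    (r : ℝ) (hr : 0 < r) (z : ℝ) :
    (1/(4*Real.pi)) * ∫ r' in Set.Ioi (0:ℝ), ∫ z' : ℝ,
        (∫ θ in (0:ℝ)..(2*Real.pi),
          a r' z' * Real.cos (m * θ) /
            Real.sqrt ((r - r')^2 + (z - z')^2 + 2*r*r'*(1 - Real.cos θ)) * r')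
      = (1/(2*Real.pi)) * ∫ r' in Set.Ioi (0:ℝ), ∫ z' : ℝ,
          Fm m (((r - r')^2 + (z - z')^2)/(r*r')) * a r' z' * Real.sqrt (r'/r) := by
  have h : ∀ r' ∈ Set.Ioi (0:ℝ), (∫ z' : ℝ, ∫ θ in (0:ℝ)..(2*Real.pi),
      a r' z' * Real.cos (m * θ) /
        Real.sqrt ((r - r')^2 + (z - z')^2 + 2*r*r'*(1 - Real.cos θ)) * r')
      = 2 * ∫ z' : ℝ, Fm m (((r - r')^2 + (z - z')^2)/(r*r')) * a r' z' * Real.sqrt (r'/r) := by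
    intro r' hr'
    simp_rw [angular_integral_eq_Fm m _ z _ hr hr', integral_const_mul]
  rw [setIntegral_congr_fun measurableSet_Ioi h, integral_const_mul]
  ring

end
end
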